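/- arXiv:1303.0784 — 2 statements merged into one kernel-verified Lean document; each statement's English description precedes it below -/
import Mathlib

section
/- Let A be an m×m matrix with integer entries and n ≥ 1 a natural number. Then n divides the integer Σ_{d ∣ n} μ(d) · tr(A^{n/d}), where μ is the Möbius function, tr the matrix trace, and the sum ranges over the positive divisors d of n. -/
open Function in
lemma gct_dvd_minimalPeriod {X : Type*} (f : X → X) (n : ℕ) (hn : 1 ≤ n)
    (hfin : {x | IsPeriodicPt f n x}.Finite) :
    n ∣ {x | minimalPeriod f x = n}.ncard := by
  classical
  have hfin' : {x | minimalPeriod f x = n}.Finite :=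
    hfin.subset (fun x hx => by
      have := isPeriodicPt_minimalPeriod f x
      rwa [show minimalPeriod f x = n from hx] at this)
  rw [Set.ncard_eq_toFinset_card _ hfin']
  rw [Finset.card_eq_sum_card_image (fun x => periodicOrbit f x)]
  apply Finset.dvd_sum
  intro o ho
  obtain ⟨x, hx, rfl⟩ := Finset.mem_image.1 ho
  have hx : minimalPeriod f x = n := by simpa using hx
  have hxp : x ∈ periodicPts f := minimalPeriod_pos_iff_mem_periodicPts.1 (by omega)
  have : (hfin'.toFinset.filter (fun y => periodicOrbit f y = periodicOrbit f x))
      = (Finset.range n).image (fun k => f^[k] x) := by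
    ext y
    simp only [Finset.mem_filter, Set.Finite.mem_toFinset, Set.mem_ofPred_eq, Finset.mem_image,
      Finset.mem_range]
    constructor
    · rintro ⟨hy, h⟩
      have hyp : y ∈ periodicPts f := minimalPeriod_pos_iff_mem_periodicPts.1 (by omega)
      have := self_mem_periodicOrbit hyp
      rw [h, mem_periodicOrbit_iff hxp] at this
      obtain ⟨k, hk⟩ := this
      refine ⟨k % n, Nat.mod_lt _ hn, ?_⟩
      rw [← hx, iterate_mod_minimalPeriod_eq, hk]
    · rintro ⟨k, hk, rfl⟩
      exact ⟨by rw [minimalPeriod_apply_iterate hxp, hx], periodicOrbit_apply_iterate_eq hxp k⟩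
  rw [this, Finset.card_image_of_injOn, Finset.card_range]
  intro a ha b hb hab
  have ha' : a < n := by simpa using ha
  have hb' : b < n := by simpa using hb
  exact (iterate_eq_iterate_iff_of_lt_minimalPeriod (by omega) (by omega)).1 hab

open Function in
lemma gct_dynamics {X : Type*} (f : X → X)
    (hfin : ∀ n, 1 ≤ n → {x | IsPeriodicPt f n x}.Finite) (n : ℕ) (hn : 1 ≤ n) :
    (n : ℤ) ∣ ∑ d ∈ n.divisors,
      (ArithmeticFunction.moebius d) * ({x | IsPeriodicPt f (n / d) x}.ncard : ℤ) := by
  classical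
  have key : ∀ n > 0, ∑ d ∈ n.divisors, ({x | minimalPeriod f x = d}.ncard : ℤ)
      = ({x | IsPeriodicPt f n x}.ncard : ℤ) := by
    intro n hn
    have hf := hfin n hn
    rw [Set.ncard_eq_toFinset_card _ hf]
    rw [Finset.card_eq_sum_card_fiberwise (f := fun x => minimalPeriod f x) (t := n.divisors)]
    · push_cast
      refine Finset.sum_congr rfl fun d hd => ?_
      rw [← Set.ncard_coe_finset]
      congr 2
      ext x
      have hd := Nat.dvd_of_mem_divisors hd
      simp only [Set.mem_ofPred_eq, Finset.coe_filter, Set.Finite.mem_toFinset]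
      constructor
      · intro h
        exact ⟨isPeriodicPt_iff_minimalPeriod_dvd.2 (h ▸ hd), h⟩
      · exact fun h => h.2
    · intro x hx
      have hx : IsPeriodicPt f n x := by simpa using hx
      simpa using ⟨hx.minimalPeriod_dvd, by omega⟩
  have := (ArithmeticFunction.sum_eq_iff_sum_mul_moebius_eq.1 key) n hn
  simp only [Int.cast_id] at this
  rw [Nat.sum_divisorsAntidiagonal
    (f := fun a b => ArithmeticFunction.moebius a * ({x | IsPeriodicPt f b x}.ncard : ℤ))]
    at this
  rw [this]
  exact_mod_cast gct_dvd_minimalPeriod f n hn (hfin n hn)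

lemma gct_pow_apply {E : Type*} [Fintype E] [DecidableEq E] (M : Matrix E E ℤ) (n : ℕ) (a b : E) :
    (M ^ n) a b = ∑ w : Fin (n + 1) → E, if w 0 = a ∧ w (Fin.last n) = b then
      ∏ i : Fin n, M (w i.castSucc) (w i.succ) else 0 := by
  induction n generalizing a with
  | zero =>
    rw [← (Equiv.funUnique (Fin 1) E).symm.sum_comp]
    simp [Matrix.one_apply, ite_and]
  | succ n ih =>
    rw [pow_succ', Matrix.mul_apply, ← (Fin.consEquiv (fun _ => E)).sum_comp,
      Fintype.sum_prod_type]
    simp only [Fin.consEquiv_apply, Fin.cons_zero, ← Fin.succ_last, Fin.cons_succ,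
      Fin.prod_univ_succ, Fin.castSucc_zero, ← Fin.succ_castSucc, ite_and]
    simp only [ih, Finset.mul_sum]
    rw [Finset.sum_comm]
    symm
    rw [Finset.sum_comm]
    refine Finset.sum_congr rfl fun w _ => ?_
    rw [Finset.sum_eq_single a (by intro c _ hc; simp [hc]) (by simp)]
    symm
    rw [Finset.sum_eq_single (w 0) (by intro c _ hc; simp [hc.symm]) (by simp)]
    simp

/-- One-sided shift space of sequences with consecutive terms related by `r`. -/
def GctX {E : Type*} (r : E → E → Prop) := {x : ℕ → E // ∀ i, r (x i) (x (i + 1))}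

def gctShift {E : Type*} (r : E → E → Prop) (x : GctX r) : GctX r :=
  ⟨fun i => x.1 (i + 1), fun i => x.2 (i + 1)⟩

lemma gctShift_iter {E : Type*} (r : E → E → Prop) (n : ℕ) (x : GctX r) (i : ℕ) :
    ((gctShift r)^[n] x).1 i = x.1 (i + n) := by
  induction n generalizing x with
  | zero => rfl
  | succ n ih => rw [Function.iterate_succ_apply, ih]; simp [gctShift]; congr 1

lemma gct_bij {E : Type*} (r : E → E → Prop) (n : ℕ) (hn : 1 ≤ n) :
    Set.BijOn (fun (x : GctX r) (i : Fin (n + 1)) => x.1 i)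
      {x | Function.IsPeriodicPt (gctShift r) n x}
      {w | w 0 = w (Fin.last n) ∧ ∀ i : Fin n, r (w i.castSucc) (w i.succ)} := by
  have per : ∀ x : GctX r, Function.IsPeriodicPt (gctShift r) n x ↔ ∀ i, x.1 (i + n) = x.1 i := by
    intro x
    constructor
    · intro h i
      rw [← gctShift_iter, h.eq]
    · intro h
      apply Subtype.ext
      funext i
      rw [gctShift_iter, h]
  refine ⟨?_, ?_, ?_⟩
  · intro x hx
    have hx := (per x).1 hx
    refine ⟨?_, fun i => x.2 i⟩
    simpa using (hx 0).symm
  · intro x hx y hy hxy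
    have hx : Function.Periodic x.1 n := (per x).1 hx
    have hy : Function.Periodic y.1 n := (per y).1 hy
    apply Subtype.ext
    funext i
    rw [← hx.map_mod_nat i, ← hy.map_mod_nat i]
    exact congrFun hxy ⟨i % n, (Nat.mod_lt _ hn).trans (Nat.lt_succ_self n)⟩
  · rintro w ⟨hw0, hw⟩
    have hlt : ∀ i, i % n < n := fun i => Nat.mod_lt _ hn
    refine ⟨⟨fun i => w ⟨i % n, (hlt i).trans (Nat.lt_succ_self n)⟩, fun i => ?_⟩, ?_, ?_⟩
    · have h := hw ⟨i % n, hlt i⟩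
      have e : w (Fin.succ ⟨i % n, hlt i⟩) =
          w ⟨(i + 1) % n, (hlt (i + 1)).trans (Nat.lt_succ_self n)⟩ := by
        have hm : (i + 1) % n = (i % n + 1) % n := by simp
        by_cases hc : i % n + 1 = n
        · rw [hc, Nat.mod_self] at hm
          have h1 : Fin.succ ⟨i % n, hlt i⟩ = Fin.last n := Fin.ext hc
          rw [h1, ← hw0]
          congr 1
          exact Fin.ext hm.symm
        · rw [Nat.mod_eq_of_lt (a := i % n + 1) (by have := hlt i; omega)] at hm
          congr 1
          exact Fin.ext hm.symm
      rw [e] at h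
      exact h
    · refine (per _).2 fun i => ?_
      simp
    · funext i
      by_cases hi : i.1 = n
      · have : i = Fin.last n := Fin.ext hi
        subst this
        simp only [Fin.val_last, Nat.mod_self]
        exact hw0
      · have : i.1 % n = i.1 := Nat.mod_eq_of_lt (by omega)
        simp [this]

lemma gct_trace_zero_one {E : Type*} [Fintype E] [DecidableEq E] (r : E → E → Prop)
    [DecidableRel r] (n : ℕ) (hn : 1 ≤ n) :
    (Matrix.trace ((Matrix.of fun a b => if r a b then (1 : ℤ) else 0) ^ n)) =
      ({x | Function.IsPeriodicPt (gctShift r) n x}.ncard : ℤ) := by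
  classical
  rw [← (gct_bij r n hn).injOn.ncard_image, (gct_bij r n hn).image_eq]
  rw [Set.ncard_eq_toFinset_card', Matrix.trace]
  simp only [Matrix.diag_apply, gct_pow_apply]
  rw [Finset.sum_comm]
  rw [Set.toFinset_ofPred, Finset.card_filter]
  push_cast
  refine Finset.sum_congr rfl fun w _ => ?_
  simp only [ite_and]
  rw [Finset.sum_eq_single (w 0) (by intro c _ hc; simp [hc.symm]) (by simp)]
  simp only [Matrix.of_apply, Finset.prod_ite_zero, if_true, eq_comm (a := w (Fin.last n))]
  simp

lemma gct_trace_swap {E F : Type*} [Fintype E] [DecidableEq E] [Fintype F] [DecidableEq F]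
    (S : Matrix F E ℤ) (T : Matrix E F ℤ) (n : ℕ) (hn : 1 ≤ n) :
    ((S * T) ^ n).trace = ((T * S) ^ n).trace := by
  obtain ⟨k, rfl⟩ : ∃ k, n = k + 1 := ⟨n - 1, by omega⟩
  have h : ∀ k, T * (S * T) ^ k = (T * S) ^ k * T := by
    intro k
    induction k with
    | zero => simp
    | succ k ih => rw [pow_succ, ← Matrix.mul_assoc, ih, pow_succ]; simp only [Matrix.mul_assoc]
  rw [pow_succ', Matrix.mul_assoc, Matrix.trace_mul_comm, h, pow_succ, Matrix.mul_assoc]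

lemma gct_nat (m : ℕ) (B : Fin m → Fin m → ℕ) (n : ℕ) (hn : 1 ≤ n) :
    (n : ℤ) ∣ ∑ d ∈ n.divisors,
      (ArithmeticFunction.moebius d) *
        ((Matrix.of fun i j => (B i j : ℤ)) ^ (n / d)).trace := by
  classical
  let E := Σ p : Fin m × Fin m, Fin (B p.1 p.2)
  let S : Matrix (Fin m) E ℤ := Matrix.of fun i e => if e.1.1 = i then 1 else 0
  let T : Matrix E (Fin m) ℤ := Matrix.of fun e j => if e.1.2 = j then 1 else 0
  let r : E → E → Prop := fun e e' => e'.1.1 = e.1.2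
  have hST : (Matrix.of fun i j => (B i j : ℤ)) = S * T := by
    ext i j
    simp only [Matrix.mul_apply, S, T, Matrix.of_apply, E]
    rw [Fintype.sum_sigma, Fintype.sum_prod_type]
    simp only [mul_ite, mul_one, mul_zero]
    rw [Finset.sum_eq_single i (by intro c _ hc; simp [hc]) (by simp),
      Finset.sum_eq_single j (by intro c _ hc; simp [hc]) (by simp)]
    simp
  have hTS : T * S = Matrix.of fun a b => if r a b then (1 : ℤ) else 0 := by
    ext a b
    simp [Matrix.mul_apply, S, T, r, eq_comm]
  have hfin : ∀ n, 1 ≤ n → {x | Function.IsPeriodicPt (gctShift r) n x}.Finite := fun n hn =>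
    Set.Finite.of_injOn (gct_bij r n hn).mapsTo (gct_bij r n hn).injOn (Set.toFinite _)
  convert gct_dynamics (gctShift r) hfin n hn using 1
  refine Finset.sum_congr rfl fun d hd => ?_
  have h1 : 1 ≤ n / d := Nat.div_pos (Nat.divisor_le hd) (Nat.pos_of_mem_divisors hd)
  rw [hST, gct_trace_swap _ _ _ h1, hTS, gct_trace_zero_one r _ h1]

/-- Gauss congruence for traces of integer matrices:
`n ∣ Σ_{d ∣ n} μ(d)·tr(A^{n/d})`. -/
theorem gauss_congruence_trace (m : ℕ) (A : Matrix (Fin m) (Fin m) ℤ)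
    (n : ℕ) (hn : 1 ≤ n) :
    (n : ℤ) ∣ ∑ d ∈ n.divisors,
      (ArithmeticFunction.moebius d) * (A ^ (n / d)).trace := by
  have h := gct_nat m (fun i j => (A i j % n).toNat) n hn
  rw [← ZMod.intCast_zmod_eq_zero_iff_dvd] at h ⊢
  rw [← h]
  push_cast
  refine Finset.sum_congr rfl fun d _ => ?_
  congr 1
  have hm : ∀ (C : Matrix (Fin m) (Fin m) ℤ) (k : ℕ), (((C ^ k).trace : ℤ) : ZMod n) =
      ((C.map (Int.castRingHom (ZMod n))) ^ k).trace := by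
    intro C k
    have := AddMonoidHom.map_trace (Int.castRingHom (ZMod n)) (C ^ k)
    rw [← Matrix.map_pow]
    exact this
  rw [hm, hm]
  congr 2
  ext i j
  have : (((A i j % n).toNat : ℕ) : ℤ) = A i j % n :=
    Int.toNat_of_nonneg (Int.emod_nonneg _ (by omega))
  simp only [Matrix.map_apply, Matrix.of_apply, this]
  simp
end

section
/- For i = 0,…,m let A_i be a square matrix with integer entries (of size m_i × m_i), and define L(k) = Σ_{i=0}^{m} (−1)^i · tr(A_i^k) for k ≥ 1. Then for every n ≥ 1, n divides the integer Σ_{d ∣ n} μ(n/d) · L(d), where μ is the Möbius function and the sum ranges over the positive divisors d of n. -/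
lemma dold_card_min {X : Type*} (f : X → X) (n : ℕ) (hn : 1 ≤ n) (F : Finset X)
    (hF : ∀ x, x ∈ F ↔ Function.minimalPeriod f x = n) : n ∣ F.card := by
  classical
  rw [Finset.card_eq_sum_card_image (fun x => Function.periodicOrbit f x) F]
  apply Finset.dvd_sum
  intro c hc
  obtain ⟨x, hx, rfl⟩ := Finset.mem_image.1 hc
  rw [hF] at hx
  have hxp : x ∈ Function.periodicPts f := by
    rw [← Function.minimalPeriod_pos_iff_mem_periodicPts]; omega
  have : F.filter (fun y => Function.periodicOrbit f y = Function.periodicOrbit f x)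
      = (Finset.range n).image (fun k => f^[k] x) := by
    ext y
    simp only [Finset.mem_filter, hF, Finset.mem_image, Finset.mem_range]
    constructor
    · rintro ⟨hy, h⟩
      have hyp : y ∈ Function.periodicPts f := by
        rw [← Function.minimalPeriod_pos_iff_mem_periodicPts]; omega
      have h1 := Function.self_mem_periodicOrbit hyp
      rw [h, Function.mem_periodicOrbit_iff hxp] at h1
      obtain ⟨k, hk⟩ := h1
      refine ⟨k % n, Nat.mod_lt _ hn, ?_⟩
      rw [← hx, Function.iterate_mod_minimalPeriod_eq, hk]
    · rintro ⟨k, hk, rfl⟩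
      exact ⟨by rw [Function.minimalPeriod_apply_iterate hxp, hx],
        Function.periodicOrbit_apply_iterate_eq hxp k⟩
  rw [this, Finset.card_image_of_injOn, Finset.card_range]
  intro a ha b hb h
  simp only [Finset.coe_range, Set.mem_Iio] at ha hb
  exact Function.iterate_injOn_Iio_minimalPeriod (f := f) (x := x)
    (by simpa [hx] using ha) (by simpa [hx] using hb) h

lemma dold_dyn {X : Type*} (f : X → X)
    (hfin : ∀ d, 1 ≤ d → (Function.ptsOfPeriod f d).Finite) (n : ℕ) (hn : 1 ≤ n) :
    (n : ℤ) ∣ ∑ d ∈ n.divisors, (ArithmeticFunction.moebius (n / d)) *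
      ((Function.ptsOfPeriod f d).ncard : ℤ) := by
  classical
  have hfin2 : ∀ d, 1 ≤ d → {x | Function.minimalPeriod f x = d}.Finite := by
    intro d hd
    refine (hfin d hd).subset ?_
    rintro x rfl
    exact Function.isPeriodicPt_minimalPeriod f x
  have key := (ArithmeticFunction.sum_eq_iff_sum_mul_moebius_eq (R := ℤ)
    (f := fun d => ({x | Function.minimalPeriod f x = d}.ncard : ℤ))
    (g := fun d => ((Function.ptsOfPeriod f d).ncard : ℤ))).1 ?_ n hn
  · simp only [Int.cast_id] at key
    rw [Nat.sum_divisorsAntidiagonal'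
      (f := fun a b => (ArithmeticFunction.moebius a : ℤ) *
        ((Function.ptsOfPeriod f b).ncard : ℤ))] at key
    rw [key, Set.ncard_eq_toFinset_card _ (hfin2 n hn)]
    exact_mod_cast dold_card_min f n hn _ (by simp)
  · intro d hd
    have hd' : 1 ≤ d := hd
    rw [Set.ncard_eq_toFinset_card _ (hfin d hd)]
    rw [Finset.card_eq_sum_card_fiberwise (f := fun x => Function.minimalPeriod f x)
      (t := d.divisors)]
    · push_cast
      refine Finset.sum_congr rfl fun e he => ?_
      have he' := Nat.mem_divisors.1 he
      rw [Set.ncard_eq_toFinset_card _ (hfin2 e (Nat.pos_of_mem_divisors he))]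
      congr 2
      ext x
      simp only [Set.Finite.mem_toFinset, Set.mem_ofPred_eq, Finset.mem_filter]
      constructor
      · rintro rfl
        exact ⟨(Function.isPeriodicPt_iff_minimalPeriod_dvd).2 he'.1, rfl⟩
      · exact fun h => h.2
    · intro x hx
      simp only [Set.Finite.coe_toFinset] at hx
      simp only [Finset.mem_coe, Nat.mem_divisors]
      exact ⟨Function.IsPeriodicPt.minimalPeriod_dvd hx, by omega⟩

lemma dold_pow {E : Type*} [Fintype E] [DecidableEq E] (R : Matrix E E ℤ) (d : ℕ) (i j : E) :
    (R ^ d) i j = ∑ g : Fin (d + 1) → E, if g 0 = i ∧ g (Fin.last d) = j then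
      ∏ k : Fin d, R (g k.castSucc) (g k.succ) else 0 := by
  induction d generalizing i with
  | zero =>
    rw [← (Equiv.funUnique (Fin 1) E).symm.sum_comp]
    simp [Matrix.one_apply, ite_and]
  | succ d ih =>
    rw [pow_succ', Matrix.mul_apply, ← (Fin.consEquiv (fun _ => E)).sum_comp,
      Fintype.sum_prod_type]
    simp only [ih, Finset.mul_sum]
    rw [Finset.sum_comm, Finset.sum_comm (s := (Finset.univ : Finset E))]
    refine Finset.sum_congr rfl fun g _ => ?_
    simp [Fin.prod_univ_succ, ite_and, ← Fin.succ_last, -Fin.castSucc_succ, ← Fin.succ_castSucc]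

lemma dold_trace {E : Type*} [Fintype E] [DecidableEq E] (S : E → E → Prop) [DecidableRel S]
    (d : ℕ) : ((Matrix.of fun i j => if S i j then (1 : ℤ) else 0) ^ d).trace =
    Fintype.card {g : Fin (d + 1) → E // g 0 = g (Fin.last d) ∧
      ∀ k : Fin d, S (g k.castSucc) (g k.succ)} := by
  simp only [Matrix.trace, Matrix.diag_apply, dold_pow, Matrix.of_apply]
  rw [Finset.sum_comm, Fintype.card_subtype, Finset.card_filter]
  push_cast
  refine Finset.sum_congr rfl fun g _ => ?_
  simp only [ite_and, Finset.prod_ite_zero, Finset.prod_const_one]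
  simp [eq_comm]

def doldX {E : Type*} (S : E → E → Prop) : Type _ := {x : ℕ → E // ∀ k, S (x k) (x (k+1))}

def doldShift {E : Type*} (S : E → E → Prop) (x : doldX S) : doldX S :=
  ⟨fun k => x.1 (k+1), fun k => x.2 (k+1)⟩

lemma doldShift_iter {E : Type*} (S : E → E → Prop) (x : doldX S) (d k : ℕ) :
    ((doldShift S)^[d] x).1 k = x.1 (k + d) := by
  induction d generalizing x with
  | zero => rfl
  | succ d ih => rw [Function.iterate_succ_apply, ih]; simp [doldShift, add_assoc]

lemma dold_mem {E : Type*} (S : E → E → Prop) (x : doldX S) (d : ℕ) :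
    x ∈ Function.ptsOfPeriod (doldShift S) d ↔ ∀ k, x.1 (k + d) = x.1 k := by
  constructor
  · intro h k
    rw [← doldShift_iter, show (doldShift S)^[d] x = x from h]
  · intro h
    refine Subtype.ext (funext fun k => ?_)
    rw [doldShift_iter, h]

noncomputable def doldEquiv {E : Type*} (S : E → E → Prop) (d : ℕ) (hd : 1 ≤ d) :
    Function.ptsOfPeriod (doldShift S) d ≃ {g : Fin (d + 1) → E // g 0 = g (Fin.last d) ∧
      ∀ k : Fin d, S (g k.castSucc) (g k.succ)} where
  toFun x := ⟨fun k => x.1.1 k, by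
    have := (dold_mem S x.1 d).1 x.2 0
    simpa using this.symm, fun k => by simpa using x.1.2 k⟩
  invFun g := ⟨⟨fun k => g.1 ⟨k % d, (Nat.mod_lt _ hd).trans (Nat.lt_succ_self d)⟩, fun k => by
      have h := g.2.2 ⟨k % d, Nat.mod_lt _ hd⟩
      have hlt := Nat.mod_lt k hd
      rcases Nat.lt_or_ge (k % d + 1) d with h1 | h1
      · have : (k + 1) % d = k % d + 1 := by
          rw [Nat.add_mod, ← Nat.mod_eq_of_lt h1]; simp
        simpa [this] using h
      · have h2 : k % d + 1 = d := by omega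
        have : (k + 1) % d = 0 := by
          rw [← Nat.mod_add_mod, h2, Nat.mod_self]
        have h3 : (Fin.succ ⟨k % d, Nat.mod_lt _ hd⟩ : Fin (d+1)) = Fin.last d := by
          ext; simpa using h2
        rw [h3, ← g.2.1] at h
        simpa [this] using h⟩, by
      refine (dold_mem S _ d).2 ?_; intro k; simp⟩
  left_inv x := by
    apply Subtype.ext; apply Subtype.ext; funext k
    have hx := (dold_mem S x.1 d).1 x.2
    exact Function.Periodic.map_mod_nat (f := x.1.1) hx k
  right_inv g := by
    apply Subtype.ext; funext k
    rcases Nat.lt_or_ge k d with h | h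
    · simp [Nat.mod_eq_of_lt h]
    · have : k = Fin.last d := by ext; simp; omega
      subst this
      simpa using g.2.1

lemma dold_zero_one {E : Type*} [Fintype E] [DecidableEq E] (S : E → E → Prop) [DecidableRel S]
    (n : ℕ) (hn : 1 ≤ n) :
    (n : ℤ) ∣ ∑ d ∈ n.divisors, (ArithmeticFunction.moebius (n / d)) *
      ((Matrix.of fun i j => if S i j then (1 : ℤ) else 0) ^ d).trace := by
  convert dold_dyn (doldShift S) (fun d hd => ?_) n hn using 3 with d hd
  · rw [dold_trace, ← Nat.card_coe_set_eq,
      Nat.card_congr (doldEquiv S d (Nat.pos_of_mem_divisors hd)), Nat.card_eq_fintype_card]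
  · exact Finite.of_equiv _ (doldEquiv S d hd).symm

lemma dold_trace_comm {I E : Type*} [Fintype E] [DecidableEq E] [Fintype I] [DecidableEq I]
    (P : Matrix I E ℤ) (Q : Matrix E I ℤ) (d : ℕ) (hd : 1 ≤ d) :
    ((P * Q) ^ d).trace = ((Q * P) ^ d).trace := by
  obtain ⟨d, rfl⟩ := Nat.exists_eq_add_of_le' hd
  have h : ∀ e : ℕ, (P * Q) ^ e * P = P * (Q * P) ^ e := by
    intro e
    induction e with
    | zero => simp
    | succ e ih => rw [pow_succ', Matrix.mul_assoc, ih, pow_succ']; simp only [Matrix.mul_assoc]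
  rw [pow_succ, ← Matrix.mul_assoc, h, Matrix.mul_assoc, Matrix.trace_mul_comm, pow_succ,
    Matrix.mul_assoc]

lemma dold_nat {I : Type*} [Fintype I] [DecidableEq I] (a : I → I → ℕ) (n : ℕ) (hn : 1 ≤ n) :
    (n : ℤ) ∣ ∑ d ∈ n.divisors, (ArithmeticFunction.moebius (n / d)) *
      ((Matrix.of fun i j => (a i j : ℤ)) ^ d).trace := by
  let E := Σ p : I × I, Fin (a p.1 p.2)
  let P : Matrix I E ℤ := Matrix.of fun i e => if e.1.1 = i then 1 else 0
  let Q : Matrix E I ℤ := Matrix.of fun e j => if e.1.2 = j then 1 else 0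
  have h1 : (Matrix.of fun i j => (a i j : ℤ)) = P * Q := by
    ext i j
    simp only [Matrix.mul_apply, P, Q, E, Matrix.of_apply, Fintype.sum_sigma,
      Fintype.sum_prod_type]
    simp [apply_ite Finset.card]
  have h2 : Q * P = Matrix.of fun e e' : E => if e.1.2 = e'.1.1 then (1 : ℤ) else 0 := by
    ext e e'
    simp [Matrix.mul_apply, P, Q, eq_comm]
  convert dold_zero_one (fun e e' : E => e.1.2 = e'.1.1) n hn using 3 with d hd
  rw [h1, dold_trace_comm _ _ _ (Nat.pos_of_mem_divisors hd), h2]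

lemma dold_int {I : Type*} [Fintype I] [DecidableEq I] (A : Matrix I I ℤ) (n : ℕ) (hn : 1 ≤ n) :
    (n : ℤ) ∣ ∑ d ∈ n.divisors, (ArithmeticFunction.moebius (n / d)) * (A ^ d).trace := by
  have h := dold_nat (fun i j => (A i j % n).toNat) n hn
  rw [← ZMod.intCast_zmod_eq_zero_iff_dvd] at h ⊢
  rw [← h]
  have hB : A.map (Int.castRingHom (ZMod n)) =
    (Matrix.of fun i j => (((A i j % n).toNat : ℕ) : ℤ)).map (Int.castRingHom (ZMod n)) := by
    ext i j
    have : (((A i j % n).toNat : ℕ) : ℤ) = A i j % n :=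
      Int.toNat_of_nonneg (Int.emod_nonneg _ (by omega))
    simp only [Matrix.map_apply, Matrix.of_apply, this]
    simp
  have ht : ∀ (B : Matrix I I ℤ) (d : ℕ), (((B ^ d).trace : ℤ) : ZMod n) =
      ((B.map (Int.castRingHom (ZMod n))) ^ d).trace := by
    intro B d
    rw [← Matrix.map_pow]
    exact AddMonoidHom.map_trace (Int.castRingHom (ZMod n)).toAddMonoidHom _
  push_cast
  simp only [ht, hB]

/-- Dold congruence for Lefschetz-number-type sequences: with
`L(k) = Σᵢ (−1)ⁱ·tr(Aᵢᵏ)` for integer matrices `Aᵢ`, one has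
`n ∣ Σ_{d ∣ n} μ(n/d)·L(d)`. -/
theorem dold_congruence_lefschetz (m : ℕ) (sz : Fin (m + 1) → ℕ)
    (A : (i : Fin (m + 1)) → Matrix (Fin (sz i)) (Fin (sz i)) ℤ)
    (n : ℕ) (hn : 1 ≤ n) :
    (n : ℤ) ∣ ∑ d ∈ n.divisors, (ArithmeticFunction.moebius (n / d)) *
      (∑ i : Fin (m + 1), (-1 : ℤ) ^ (i : ℕ) * (A i ^ d).trace) := by
  simp only [Finset.mul_sum]
  rw [Finset.sum_comm]
  refine Finset.dvd_sum fun i _ => ?_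
  simp only [mul_left_comm _ ((-1 : ℤ) ^ (i : ℕ)), ← Finset.mul_sum]
  exact Dvd.dvd.mul_left (dold_int (A i) n hn) _
end
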